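/- arXiv:1508.02662 — 2 statements merged into one kernel-verified Lean document; each statement's English description precedes it below -/
import Mathlib

section
/- Let G be an infinite abelian group, A ⊆ G a basis (hA ∼ G for some h), and a ∈ A. Then A \ {a} is a basis of G (of some order) if and only if the subgroup generated by (A \ {a}) − (A \ {a}) equals G. -/
open Pointwise

/-- `itSum A n` is the `n`-fold sumset of `A` (sums of exactly `n` elements of `A`). -/
def itSum {G : Type*} [AddCommGroup G] (A : Set G) : ℕ → Set G
  | 0 => {0}
  | n + 1 => itSum A n + A

/-- `SimEq A B` means the symmetric difference of `A` and `B` is finite. -/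
def SimEq {G : Type*} [AddCommGroup G] (A B : Set G) : Prop :=
  (symmDiff A B).Finite

section Helpers

variable {G : Type*} [AddCommGroup G]

theorem itSum_eq_nsmul (A : Set G) (n : ℕ) : itSum A n = n • A := by
  induction n with
  | zero => simp [itSum, Set.singleton_zero]
  | succ n ih => rw [itSum, ih, succ_nsmul]

theorem simEq_univ_iff (S : Set G) : SimEq S Set.univ ↔ Sᶜ.Finite := by
  rw [SimEq, ← Set.top_eq_univ, symmDiff_top, hnot_eq_compl]

/-- Differences of two elements of `n • B` lie in the subgroup generated by `B - B`. -/
theorem sub_mem_closure_sub_of_mem_nsmul {B : Set G} {n : ℕ} {x y : G}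
    (hx : x ∈ n • B) (hy : y ∈ n • B) : x - y ∈ AddSubgroup.closure (B - B) := by
  induction n generalizing x y with
  | zero => simp_all
  | succ n ih =>
    rw [succ_nsmul] at hx hy
    obtain ⟨x', hx', b, hb, rfl⟩ := hx
    obtain ⟨y', hy', c, hc, rfl⟩ := hy
    rw [add_sub_add_comm]
    exact add_mem (ih hx' hy') (AddSubgroup.subset_closure (Set.sub_mem_sub hb hc))

/-- Every element of the subgroup generated by `B - B` is a difference of two elements
of a common sumset `n • B`. -/
theorem exists_mem_nsmul_of_mem_closure_sub {B : Set G} {g : G}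
    (hg : g ∈ AddSubgroup.closure (B - B)) : ∃ n : ℕ, ∃ x ∈ n • B, ∃ y ∈ n • B, g = x - y := by
  induction hg using AddSubgroup.closure_induction with
  | mem g hg =>
    obtain ⟨x, hx, y, hy, rfl⟩ := hg
    exact ⟨1, x, by rwa [one_nsmul], y, by rwa [one_nsmul], rfl⟩
  | zero => exact ⟨0, 0, by simp, 0, by simp, by simp⟩
  | add g g' _ _ ih ih' =>
    obtain ⟨n, x, hx, y, hy, rfl⟩ := ih
    obtain ⟨n', x', hx', y', hy', rfl⟩ := ih'
    refine ⟨n + n', x + x', ?_, y + y', ?_, by abel⟩ <;> rw [add_nsmul] <;>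
      apply Set.add_mem_add <;> assumption
  | neg g _ ih =>
    obtain ⟨n, x, hx, y, hy, rfl⟩ := ih
    exact ⟨n, y, hy, x, hx, by abel⟩

/-- If some sumset of `B` is cofinite in an infinite group, then `B - B` generates the group. -/
theorem closure_sub_eq_top_of_finite_compl_nsmul [Infinite G] {B : Set G} {k : ℕ}
    (hk : (k • B)ᶜ.Finite) : AddSubgroup.closure (B - B) = ⊤ := by
  rw [AddSubgroup.eq_top_iff']
  by_contra! hne
  obtain ⟨g, hg⟩ := hne
  have hsub : (· + g) '' (k • B) ⊆ (k • B)ᶜ := by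
    rintro _ ⟨x, hx, rfl⟩ hxg
    exact hg (by simpa using sub_mem_closure_sub_of_mem_nsmul hxg hx)
  have hfin : (k • B).Finite := (hk.subset hsub).of_finite_image (add_left_injective g).injOn
  exact Set.infinite_univ (Set.union_compl_self (k • B) ▸ hfin.union hk)

/-- If the differences of `A \ {a}` generate a nontrivial group, then some translate of `A`
is contained in a sumset of `A \ {a}`. -/
theorem exists_add_singleton_subset_nsmul_diff_singleton [Nontrivial G] {A : Set G} {a : G}
    (hB : AddSubgroup.closure ((A \ {a}) - (A \ {a})) = ⊤) :
    ∃ (m : ℕ) (x : G), A + {x} ⊆ (m + 1) • (A \ {a}) := by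
  obtain ⟨b, hb⟩ : (A \ {a}).Nonempty := by
    by_contra! hempty
    rw [hempty, Set.empty_sub, AddSubgroup.closure_empty] at hB
    exact bot_ne_top hB
  obtain ⟨m, x, hx, y, hy, hxy⟩ :=
    exists_mem_nsmul_of_mem_closure_sub (hB ▸ AddSubgroup.mem_top (b - a))
  refine ⟨m, x, ?_⟩
  rw [Set.add_singleton, succ_nsmul]
  rintro _ ⟨c, hc, rfl⟩
  by_cases hca : c = a
  · exact ⟨y, hy, b, hb, by simpa [hca, add_comm] using (sub_eq_sub_iff_add_eq_add.1 hxy)⟩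
  · exact ⟨_, hx, c, ⟨hc, hca⟩, add_comm _ _⟩

end Helpers

theorem stmt_4 {G : Type*} [AddCommGroup G] [Infinite G] (A : Set G) (h : ℕ)
    (hh : 1 ≤ h) (hA : SimEq (itSum A h) Set.univ) (a : G) (ha : a ∈ A) :
    (∃ k, 1 ≤ k ∧ SimEq (itSum (A \ {a}) k) Set.univ) ↔
      AddSubgroup.closure ((A \ {a}) - (A \ {a})) = ⊤ := by
  simp only [simEq_univ_iff, itSum_eq_nsmul] at hA ⊢
  refine ⟨fun ⟨k, _, hk⟩ => closure_sub_eq_top_of_finite_compl_nsmul hk, fun hB => ?_⟩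
  obtain ⟨m, x, hx⟩ := exists_add_singleton_subset_nsmul_diff_singleton hB
  refine ⟨(m + 1) * h, Nat.mul_pos m.succ_pos hh, (hA.image (· + h • x)).subset ?_⟩
  intro g hg
  refine ⟨g - h • x, fun hgx => hg ?_, sub_add_cancel _ _⟩
  rw [mul_nsmul]
  refine Set.nsmul_subset_nsmul_left hx ?_
  rw [nsmul_add]
  exact ⟨_, hgx, _, Set.nsmul_mem_nsmul (Set.mem_singleton x), sub_add_cancel _ _⟩
end

section
/- Let G be an infinite abelian group and h ≥ 2 an integer. Then G has a nice minimal basis of order h: a set B ⊆ G with hB = G, h the smallest such integer, and such that for every b ∈ B, h(B \ {b}) ≠ G (in fact every element of the form with b essential has order strictly greater than h in B \ {b}). -/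
open Pointwise

open Cardinal

universe u

theorem mk_image2_lt {α β γ : Type u} {κ : Cardinal.{u}} (hκ : ℵ₀ ≤ κ) (f : α → β → γ)
    {S : Set α} {T : Set β} (hS : #S < κ) (hT : #T < κ) : #(Set.image2 f S T) < κ := by
  rw [← Set.image_prod]
  refine mk_image_le.trans_lt ?_
  rw [mk_setProd]
  simpa using mul_lt_of_lt hκ hS hT

theorem mk_biUnion_finset_lt {α : Type u} {β : Type*} {κ : Cardinal.{u}} (hκ : ℵ₀ ≤ κ)
    (Q : Finset β) (S : β → Set α) (hS : ∀ r ∈ Q, #(S r) < κ) : #(⋃ r ∈ Q, S r) < κ := by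
  classical
  induction Q using Finset.induction_on with
  | empty => simpa using (aleph0_pos.trans_le hκ)
  | insert a Q ha ih =>
    rw [Finset.set_biUnion_insert]
    exact (mk_union_le _ _).trans_lt (add_lt_of_lt hκ (hS a (by simp))
      (ih fun r hr => hS r (by simp [hr])))

theorem mk_finite_lt {α : Type u} {κ : Cardinal.{u}} (hκ : ℵ₀ ≤ κ) {S : Set α} (hS : S.Finite) :
    #S < κ :=
  (lt_aleph0_iff_set_finite.2 hS).trans_le hκ

section Generic

variable {G : Type u} [AddCommGroup G]

/-- If `r • G` is as large as `G` for each of finitely many integers `r`, then fewer than `#G`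
constraints of the form `r • e = s` can be avoided simultaneously. -/
theorem exists_zsmul_notMem [Infinite G] (Q : Finset ℤ)
    (hQ : ∀ r ∈ Q, #G ≤ #(Set.range fun e : G => r • e)) (S : Set G) (hS : #S < #G) :
    ∃ e : G, ∀ r ∈ Q, r • e ∉ S := by
  classical
  have hκ : ℵ₀ ≤ #G := aleph0_le_mk G
  induction Q using Finset.induction_on generalizing S with
  | empty => exact ⟨0, by simp⟩
  | insert r Q hr ih =>
    by_contra! hcon
    have hy : ¬ (Set.range fun e : G => r • e) ⊆ S := fun hsub =>
      absurd (mk_le_mk_of_subset hsub) (not_le.2 (hS.trans_le (hQ r (by simp))))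
    obtain ⟨_, ⟨e₀, rfl⟩, he₀⟩ := Set.not_subset.1 hy
    let p : G → G := Function.invFun fun e : G => r • e
    have hp : ∀ e, r • p (r • e) = r • e := fun e =>
      Function.invFun_eq (f := fun e : G => r • e) ⟨e, rfl⟩
    let S' : Set G := S ∪ ⋃ q ∈ Q, Set.image2 (fun s s' => s + q • (p s' - e₀)) S S
    obtain ⟨e, he⟩ := ih (fun q hq => hQ q (by simp [hq])) S'
      ((mk_union_le _ _).trans_lt (add_lt_of_lt hκ hS
        (mk_biUnion_finset_lt hκ _ _ fun q _ => mk_image2_lt hκ _ hS hS)))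
    by_cases hre : r • e ∈ S
    · obtain ⟨q, hq, hqS⟩ := hcon (e - p (r • e) + e₀)
      rcases Finset.mem_insert.1 hq with rfl | hq
      · refine he₀ ?_
        simpa [smul_add, smul_sub, hp] using hqS
      · refine he q hq (Or.inr (Set.mem_biUnion hq ⟨_, hqS, _, hre, ?_⟩))
        simp only [smul_add, smul_sub]
        abel
    · obtain ⟨q, hq, hqS⟩ := hcon e
      rcases Finset.mem_insert.1 hq with rfl | hq
      · exact hre hqS
      · exact he q hq (Or.inl hqS)

/-- The integers `r` for which `r • G` is smaller than `G` form a proper subgroup, whose action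
on `G` takes values in one small subgroup. -/
theorem exists_small_multiples [Infinite G] :
    ∃ (M : AddSubgroup ℤ) (F : AddSubgroup G), #F < #G ∧ (1 : ℤ) ∉ M ∧
      (∀ r ∈ M, ∀ e : G, r • e ∈ F) ∧
      ∀ r ∉ M, #G ≤ #(Set.range fun e : G => r • e) := by
  have hκ : ℵ₀ ≤ #G := aleph0_le_mk G
  let M : AddSubgroup ℤ :=
    { carrier := {r | #(Set.range fun e : G => r • e) < #G}
      zero_mem' := by
        refine mk_finite_lt hκ ((Set.finite_singleton (0 : G)).subset ?_)
        rintro _ ⟨e, rfl⟩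
        simp
      add_mem' := by
        intro a b ha hb
        refine (mk_le_mk_of_subset ?_).trans_lt (mk_image2_lt hκ (fun x y : G => x + y) ha hb)
        rintro _ ⟨e, rfl⟩
        exact ⟨_, ⟨e, rfl⟩, _, ⟨e, rfl⟩, (add_smul a b e).symm⟩
      neg_mem' := by
        intro a ha
        refine (mk_le_mk_of_subset ?_).trans_lt ((mk_image_le (f := fun x : G => -x)).trans_lt ha)
        rintro _ ⟨e, rfl⟩
        exact ⟨_, ⟨e, rfl⟩, (neg_smul a e).symm⟩ }
  obtain ⟨m, hm⟩ := Int.subgroup_cyclic M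
  have hmM : m ∈ M := by rw [hm]; exact AddSubgroup.subset_closure rfl
  refine ⟨M, (zsmulAddGroupHom (α := G) m).range, hmM, fun h1 => ?_, fun r hr e => ?_,
    fun r hr => not_lt.1 hr⟩
  · have h2 : #(Set.range fun e : G => (1 : ℤ) • e) < #G := h1
    have h3 : (Set.range fun e : G => (1 : ℤ) • e) = Set.univ :=
      Set.eq_univ_of_forall fun e => ⟨e, one_smul _ _⟩
    rw [h3, mk_univ] at h2
    exact h2.false
  · rw [hm, AddSubgroup.mem_closure_singleton] at hr
    obtain ⟨n, rfl⟩ := hr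
    exact ⟨n • e, by simp [← mul_smul, mul_comm]⟩

/-- Families that are independent, modulo coefficients in `M`, over a small set. -/
theorem exists_generic [Infinite G] (M : AddSubgroup ℤ) (F : AddSubgroup G)
    (hMF : ∀ r ∈ M, ∀ e : G, r • e ∈ F)
    (hM : ∀ r ∉ M, #G ≤ #(Set.range fun e : G => r • e)) (Q : Finset ℤ) (S : Set G)
    (hS : #S < #G) (hSF : ∀ s ∈ S, ∀ f ∈ F, s + f ∈ S) (A : Type*) [Fintype A] :
    ∃ e : A → G, ∀ n : A → ℤ, (∀ a, n a ∈ Q) → ∑ a, n a • e a ∈ S → ∀ a, n a ∈ M := by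
  classical
  have hκ : ℵ₀ ≤ #G := aleph0_le_mk G
  have key : ∀ K : ℕ, ∃ e : Fin K → G,
      ∀ n : Fin K → ℤ, (∀ a, n a ∈ Q) → ∑ a, n a • e a ∈ S → ∀ a, n a ∈ M := by
    intro K
    induction K with
    | zero => exact ⟨Fin.elim0, fun n _ _ a => a.elim0⟩
    | succ K ih =>
      obtain ⟨e, he⟩ := ih
      obtain ⟨e₀, he₀⟩ := exists_zsmul_notMem (Q.filter (· ∉ M))
        (fun r hr => hM r (Finset.mem_filter.1 hr).2)
        (⋃ n ∈ Fintype.piFinset fun _ : Fin K => Q, (fun s => s - ∑ a, n a • e a) '' S)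
        (mk_biUnion_finset_lt hκ _ _ fun n _ => mk_image_le.trans_lt hS)
      refine ⟨Fin.cons e₀ e, fun n hn hsum => ?_⟩
      simp only [Fin.sum_univ_succ, Fin.cons_zero, Fin.cons_succ] at hsum
      have h0 : n 0 ∈ M := by
        by_contra h0
        refine he₀ (n 0) (Finset.mem_filter.2 ⟨hn 0, h0⟩)
          (Set.mem_biUnion (x := fun a => n a.succ) (by simpa using fun a => hn _) ⟨_, hsum, ?_⟩)
        simp
      have h1 := he (fun a => n a.succ) (fun a => hn _) (by
        have := hSF _ hsum _ (F.neg_mem (hMF _ h0 e₀))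
        convert this using 1
        abel)
      intro a
      exact Fin.cases h0 h1 a
  obtain ⟨e, he⟩ := key (Fintype.card A)
  refine ⟨e ∘ Fintype.equivFin A, fun n hn hsum a => ?_⟩
  have := he (n ∘ (Fintype.equivFin A).symm) (fun a => hn _) (by
    rw [← (Fintype.equivFin A).sum_comp]
    simpa using hsum) (Fintype.equivFin A a)
  simpa using this

end Generic

section Stages

variable {G : Type u} [AddCommGroup G]

theorem mem_itSum_image_iff {α : Type*} (v : α → G) (T : Set α) (n : ℕ) (x : G) :
    x ∈ itSum (v '' T) n ↔
      ∃ s : Multiset α, s.card = n ∧ (∀ a ∈ s, a ∈ T) ∧ (s.map v).sum = x := by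
  induction n generalizing x with
  | zero =>
    constructor
    · intro hx
      exact ⟨0, rfl, by simp, by simpa using (Set.mem_singleton_iff.1 hx).symm⟩
    · rintro ⟨s, hs, -, rfl⟩
      rw [Multiset.card_eq_zero.1 hs]
      simp [itSum]
  | succ n ih =>
    constructor
    · rintro ⟨y, hy, _, ⟨a, ha, rfl⟩, rfl⟩
      obtain ⟨s, hs, hT, rfl⟩ := (ih y).1 hy
      refine ⟨a ::ₘ s, by simp [hs], ?_, by simp [add_comm]⟩
      intro b hb
      rcases Multiset.mem_cons.1 hb with rfl | hb
      · exact ha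
      · exact hT b hb
    · rintro ⟨s, hs, hT, rfl⟩
      obtain ⟨a, t, rfl, ht⟩ := Multiset.card_eq_succ_iff.1 hs
      refine ⟨(t.map v).sum, (ih _).2 ⟨t, ht, fun b hb => hT b (Multiset.mem_cons_of_mem hb), rfl⟩,
        v a, ⟨a, hT a (Multiset.mem_cons_self a t), rfl⟩, ?_⟩
      simp [add_comm]

theorem sum_map_map_univ {α β : Type*} [Fintype β] (f : β → α) (v : α → G) :
    ((Finset.univ.val.map f).map v).sum = ∑ l, v (f l) := by
  rw [Multiset.map_map]
  rfl

theorem mk_itSum_lt {κ : Cardinal.{u}} (hκ : ℵ₀ ≤ κ) {B : Set G} (hB : #B < κ) (n : ℕ) :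
    #(itSum B n) < κ := by
  induction n with
  | zero => exact mk_finite_lt hκ (Set.finite_singleton 0)
  | succ n ih => exact mk_image2_lt hκ _ ih hB

/-- One stage of the construction: relative to the set `B` built so far, the family `w` consists of
`k + 1` elements with a new sum, which is `g` if `g` is not yet represented, together with `k`
further elements, and it is generic apart from that one relation. -/
structure IsStage (M : AddSubgroup ℤ) (F : AddSubgroup G) (k : ℕ) (B : Set G) (g : G)
    (w : Fin (k + 1) ⊕ Fin k → G) : Prop where
  fresh : ∑ l, w (Sum.inl l) ∉ itSum B (k + 1)
  hits : g ∈ itSum B (k + 1) ∨ ∑ l, w (Sum.inl l) = g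
  generic : ∀ n : Fin (k + 1) ⊕ Fin k → ℤ, (∀ a, |n a| ≤ k + 1) →
    ∀ p ≤ k + 1, ∀ q ≤ k + 1, ∀ x ∈ itSum B p, ∀ y ∈ itSum B q, ∀ f ∈ F,
      ∑ a, n a • w a = x - y + f →
        (∀ l l', n (Sum.inl l) - n (Sum.inl l') ∈ M) ∧ ∀ l, n (Sum.inr l) ∈ M

theorem exists_isStage [Infinite G] (M : AddSubgroup ℤ) (F : AddSubgroup G) (hF : #F < #G)
    (hMF : ∀ r ∈ M, ∀ e : G, r • e ∈ F)
    (hM : ∀ r ∉ M, #G ≤ #(Set.range fun e : G => r • e)) (k : ℕ) (B : Set G) (hB : #B < #G)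
    (g : G) : ∃ w, IsStage M F k B g w := by
  classical
  have hκ : ℵ₀ ≤ #G := aleph0_le_mk G
  obtain ⟨t, ht, hgt⟩ : ∃ t, t ∉ itSum B (k + 1) ∧ (g ∈ itSum B (k + 1) ∨ t = g) := by
    by_cases hg : g ∈ itSum B (k + 1)
    · have : itSum B (k + 1) ≠ Set.univ := fun h => by
        have := mk_itSum_lt hκ hB (k + 1)
        rw [h, mk_univ] at this
        exact this.false
      obtain ⟨t, ht⟩ := (Set.ne_univ_iff_exists_notMem _).1 this
      exact ⟨t, ht, Or.inl hg⟩
    · exact ⟨g, hg, Or.inr rfl⟩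
  let Q : Finset ℤ := Finset.Icc (-(2 * (k + 1))) (2 * (k + 1))
  let U : Set G := ⋃ p ∈ Finset.range (k + 2), itSum B p
  have hU : #U < #G := mk_biUnion_finset_lt hκ _ _ fun p _ => mk_itSum_lt hκ hB p
  let D : Set G := Set.image2 (· + ·) (Set.image2 (· - ·) U U) (F : Set G)
  have hD : #D < #G := mk_image2_lt hκ _ (mk_image2_lt hκ _ hU hU) hF
  let S : Set G := ⋃ r ∈ Q, (fun x => x - r • t) '' D
  obtain ⟨e, he⟩ := exists_generic M F hMF hM Q S
    (mk_biUnion_finset_lt hκ _ _ fun r _ => mk_image_le.trans_lt hD)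
    (by
      intro s hs f hf
      simp only [S, Set.mem_iUnion] at hs ⊢
      obtain ⟨r, hr, _, ⟨z, hz, f', hf', rfl⟩, rfl⟩ := hs
      exact ⟨r, hr, _, ⟨z, hz, f' + f, F.add_mem hf' hf, rfl⟩, by simp only; abel⟩)
    (Fin k ⊕ Fin k)
  have hsum : ∑ l, (Fin.cons (t - ∑ l, e (Sum.inl l)) (fun l => e (Sum.inl l)) :
      Fin (k + 1) → G) l = t := by
    simp [Fin.sum_univ_succ]
  refine ⟨Sum.elim (Fin.cons (t - ∑ l, e (Sum.inl l)) fun l => e (Sum.inl l))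
    fun l => e (Sum.inr l), ?_, ?_, ?_⟩
  · simpa only [Sum.elim_inl, hsum] using ht
  · simpa only [Sum.elim_inl, hsum] using hgt
  · intro n hn p hp q hq x hx y hy f hf hrel
    have h1 := he (Sum.elim (fun l => n (Sum.inl l.succ) - n (Sum.inl 0)) fun l => n (Sum.inr l))
      (by
        rintro (l | l)
        · have h1 := abs_le.1 (hn (Sum.inl l.succ))
          have h2 := abs_le.1 (hn (Sum.inl 0))
          simp only [Sum.elim_inl, Q, Finset.mem_Icc]
          constructor <;> linarith
        · have h1 := abs_le.1 (hn (Sum.inr l))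
          simp only [Sum.elim_inr, Q, Finset.mem_Icc]
          constructor <;> linarith)
      (by
        refine Set.mem_biUnion (x := n (Sum.inl 0)) ?_ ⟨x - y + f,
          ⟨x - y, ⟨x, Set.mem_biUnion (Finset.mem_range.2 (by omega)) hx, y,
            Set.mem_biUnion (Finset.mem_range.2 (by omega)) hy, rfl⟩, f, hf, rfl⟩, ?_⟩
        · have h2 := abs_le.1 (hn (Sum.inl 0))
          simp only [Q, Finset.coe_Icc, Set.mem_Icc]
          constructor <;> linarith
        · rw [← hrel]
          simp only [Fintype.sum_sum_type, Sum.elim_inl, Sum.elim_inr, Fin.sum_univ_succ,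
            Fin.cons_zero, Fin.cons_succ, sub_smul, smul_sub, Finset.sum_sub_distrib,
            Finset.smul_sum]
          abel)
    have h2 : ∀ l : Fin (k + 1), n (Sum.inl l) - n (Sum.inl 0) ∈ M := fun l =>
      Fin.cases (by simp) (fun l => h1 (Sum.inl l)) l
    refine ⟨fun l m => ?_, fun l => h1 (Sum.inr l)⟩
    simpa using M.sub_mem (h2 l) (h2 m)

/-- Iterating a choice of stages along a well-order. -/
theorem exists_stages {ι : Type*} [LinearOrder ι] [WellFoundedLT ι] {V : Type*}
    (P : Set G → ι → (V → G) → Prop)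
    (hP : ∀ (i : ι) (v : ι → V → G), ∃ w, P {x | ∃ j < i, ∃ a, v j a = x} i w) :
    ∃ v : ι → V → G, ∀ i, P {x | ∃ j < i, ∃ a, v j a = x} i (v i) := by
  classical
  let step : ∀ i : ι, (∀ j, j < i → V → G) → V → G := fun i ih =>
    Classical.epsilon (P {x | ∃ j, ∃ hj : j < i, ∃ a, ih j hj a = x} i)
  let v : ι → V → G := (wellFounded_lt (α := ι)).fix step
  refine ⟨v, fun i => ?_⟩
  have hv : v i = Classical.epsilon (P {x | ∃ j < i, ∃ a, v j a = x} i) := by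
    have := (wellFounded_lt (α := ι)).fix_eq step i
    simpa only [step, exists_prop] using this
  rw [hv]
  exact Classical.epsilon_spec (hP i v)

end Stages

section Representations

variable {G : Type u} [AddCommGroup G] {ι : Type*} [LinearOrder ι]

theorem map_sum_eq_filter_lt_add {V : Type*} [Fintype V] [DecidableEq V] (v : ι × V → G) (j : ι)
    (s : Multiset (ι × V)) (hs : ∀ a ∈ s, a.1 ≤ j) :
    (s.map v).sum = ((s.filter fun a => a.1 < j).map v).sum +
      ∑ a, (s.count (j, a) : ℤ) • v (j, a) := by
  induction s using Multiset.induction_on with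
  | empty => simp
  | cons b s ih =>
    have ih := ih fun a ha => hs a (Multiset.mem_cons_of_mem ha)
    obtain ⟨i, c⟩ := b
    rcases (hs _ (Multiset.mem_cons_self _ _)).lt_or_eq with h | h
    · have h : i < j := h
      simp [h, h.ne', ih, add_assoc]
    · obtain rfl : i = j := h
      simp [Multiset.count_cons, ih, add_smul, Finset.sum_add_distrib]
      abel

theorem card_eq_filter_lt_add {V : Type*} [Fintype V] [DecidableEq V] (j : ι)
    (s : Multiset (ι × V)) (hs : ∀ a ∈ s, a.1 ≤ j) :
    s.card = (s.filter fun a => a.1 < j).card + ∑ a, s.count (j, a) := by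
  have := map_sum_eq_filter_lt_add (fun _ => (1 : ℤ)) j s hs
  simp only [Multiset.map_const', Multiset.sum_replicate, nsmul_eq_mul, mul_one, smul_eq_mul] at this
  exact_mod_cast this

/-- The set of elements introduced before stage `i`. -/
def builtBefore {V : Type*} (v : ι → V → G) (i : ι) : Set G := {x | ∃ j < i, ∃ a, v j a = x}

theorem map_sum_mem_itSum_builtBefore {V : Type*} (v : ι → V → G) (i : ι) (s : Multiset (ι × V))
    (hs : ∀ a ∈ s, a.1 < i) :
    (s.map fun a => v a.1 a.2).sum ∈ itSum (builtBefore v i) s.card := by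
  have : builtBefore v i = (fun a : ι × V => v a.1 a.2) '' {a | a.1 < i} := by
    ext x
    constructor
    · rintro ⟨j, hj, a, rfl⟩
      exact ⟨(j, a), hj, rfl⟩
    · rintro ⟨a, ha, rfl⟩
      exact ⟨a.1, ha, a.2, rfl⟩
  rw [this]
  exact (mem_itSum_image_iff _ _ _ _).2 ⟨s, rfl, hs, rfl⟩

variable {M : AddSubgroup ℤ} {F : AddSubgroup G} {k : ℕ} {φ : ι → G}
  {v : ι → Fin (k + 1) ⊕ Fin k → G}

/-- In a representation of an element of `y + F`, where `y` is represented before stage `j`, the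
terms from stage `j` may be discarded. -/
theorem discard_stage (hM1 : (1 : ℤ) ∉ M) (hMF : ∀ r ∈ M, ∀ e : G, r • e ∈ F)
    (hv : ∀ i, IsStage M F k (builtBefore v i) (φ i) (v i)) {j : ι} {y : G}
    (hy : y ∈ itSum (builtBefore v j) (k + 1)) (s : Multiset (ι × (Fin (k + 1) ⊕ Fin k)))
    (hsj : ∀ a ∈ s, a.1 ≤ j) (hj : ∃ a ∈ s, a.1 = j)
    (hcard : s.card ≤ k ∨ s.card = k + 1 ∧ (s.map fun a => v a.1 a.2).sum = y)
    (hsum : (s.map fun a => v a.1 a.2).sum - y ∈ F) :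
    ((s.filter fun a => a.1 < j).map fun a => v a.1 a.2).sum - y ∈ F ∧
      (s.filter fun a => a.1 < j).card + 2 ≤ s.card := by
  classical
  have h1 := map_sum_eq_filter_lt_add (fun a : ι × (Fin (k + 1) ⊕ Fin k) => v a.1 a.2) j s hsj
  have h2 := card_eq_filter_lt_add j s hsj
  set s' := s.filter fun a => a.1 < j with hs'
  have hlow := map_sum_mem_itSum_builtBefore v j s' fun a ha => (Multiset.mem_filter.1 ha).2
  have hk : s.card ≤ k + 1 := by omega
  have hcount : ∀ a, s.count (j, a) ≤ k + 1 := fun a => (Multiset.count_le_card _ _).trans hk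
  obtain ⟨hinl, hinr⟩ := (hv j).generic (fun a => (s.count (j, a) : ℤ))
    (fun a => by
      rw [abs_of_nonneg (by positivity)]
      exact_mod_cast hcount a)
    (k + 1) le_rfl s'.card (by omega) y hy _ hlow _ hsum (by
      rw [h1]; abel)
  have hone : ∀ a, (s.count (j, a) : ℤ) ∈ M → s.count (j, a) ≠ 1 := by
    intro a ha h
    rw [h] at ha
    exact hM1 (by exact_mod_cast ha)
  have hM : ∀ a, (s.count (j, a) : ℤ) ∈ M := by
    by_contra! hcon
    obtain ⟨l | l, hl⟩ := hcon
    · have hpos : ∀ l', 1 ≤ s.count (j, Sum.inl l') := by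
        intro l'
        by_contra h0
        have h0 : s.count (j, Sum.inl l') = 0 := by omega
        have := hinl l l'
        rw [h0] at this
        exact hl (by simpa using this)
      have hge : k + 1 ≤ ∑ l', s.count (j, Sum.inl l') := by
        simpa using Finset.sum_le_sum (s := Finset.univ) fun l' _ => hpos l'
      rw [Fintype.sum_sum_type] at h2
      have hs'0 : s' = 0 := Multiset.card_eq_zero.1 (by omega)
      have hr0 : ∀ l', s.count (j, Sum.inr l') = 0 := by
        have : ∑ l', s.count (j, Sum.inr l') = 0 := by omega
        simpa using this
      have hl1 : ∀ l', s.count (j, Sum.inl l') = 1 := by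
        have h3 : ∑ l' : Fin (k + 1), 1 = ∑ l', s.count (j, Sum.inl l') := by
          simp only [Finset.sum_const, Finset.card_univ, Fintype.card_fin, smul_eq_mul, mul_one]
          omega
        intro l'
        exact ((Finset.sum_eq_sum_iff_of_le fun l' _ => hpos l').1 h3 l' (Finset.mem_univ _)).symm
      have hsy : (s.map fun a => v a.1 a.2).sum = y := by
        rcases hcard with h | h
        · omega
        · exact h.2
      refine (hv j).fresh ?_
      rw [← hsy] at hy
      rw [h1, hs'0] at hy
      simpa [Fintype.sum_sum_type, hr0, hl1] using hy
    · exact hl (hinr l)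
  constructor
  · have : ∑ a, (s.count (j, a) : ℤ) • v j a ∈ F := F.sum_mem fun a _ => hMF _ (hM a) _
    have := F.sub_mem hsum this
    rw [h1] at this
    convert this using 1
    abel
  · obtain ⟨⟨i, a⟩, ha, hi⟩ := hj
    obtain rfl : i = j := hi
    have h3 : s.count (i, a) ≤ ∑ a, s.count (i, a) :=
      Finset.single_le_sum (f := fun a => s.count (i, a)) (fun _ _ => Nat.zero_le _)
        (Finset.mem_univ a)
    have h4 := Multiset.one_le_count_iff_mem.2 ha
    have h5 := hone a (hM a)
    omega

/-- The witness of `b` attached to stage `i`. -/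
def stageWitness (v : ι → Fin (k + 1) ⊕ Fin k → G) (i : ι) (b : G) : G :=
  b + ∑ l, v i (Sum.inr l)

theorem count_mem_of_le_stage
    (hv : ∀ i, IsStage M F k (builtBefore v i) (φ i) (v i)) {i : ι} {b : G}
    (hb : b ∈ builtBefore v i) (s : Multiset (ι × (Fin (k + 1) ⊕ Fin k)))
    (hsi : ∀ a ∈ s, a.1 ≤ i) (hcard : s.card ≤ k + 1)
    (hsum : (s.map fun a => v a.1 a.2).sum - stageWitness v i b ∈ F) :
    (∀ l l', (s.count (i, Sum.inl l) : ℤ) - s.count (i, Sum.inl l') ∈ M) ∧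
      ∀ l, (s.count (i, Sum.inr l) : ℤ) - 1 ∈ M := by
  classical
  have h1 := map_sum_eq_filter_lt_add (fun a : ι × (Fin (k + 1) ⊕ Fin k) => v a.1 a.2) i s hsi
  have h2 := card_eq_filter_lt_add i s hsi
  set s' := s.filter fun a => a.1 < i with hs'
  have hlow := map_sum_mem_itSum_builtBefore v i s' fun a ha => (Multiset.mem_filter.1 ha).2
  have hcount : ∀ a, (s.count (i, a) : ℤ) ≤ k + 1 := fun a => by
    exact_mod_cast (Multiset.count_le_card _ _).trans hcard
  have := (hv i).generic
    (Sum.elim (fun l => (s.count (i, Sum.inl l) : ℤ)) fun l => (s.count (i, Sum.inr l) : ℤ) - 1)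
    (by
      rintro (l | l)
      · rw [Sum.elim_inl, abs_of_nonneg (by positivity)]
        exact hcount _
      · have := hcount (Sum.inr l)
        rw [Sum.elim_inr, abs_le]
        constructor <;> omega)
    1 (by omega) s'.card (by omega) b ⟨0, rfl, b, hb, zero_add b⟩ _ hlow _ hsum (by
      rw [h1]
      simp only [stageWitness, Fintype.sum_sum_type, Sum.elim_inl, Sum.elim_inr, sub_smul,
        one_smul, Finset.sum_sub_distrib]
      abel)
  simpa using this

theorem exists_max_stage {V : Type*} (s : Multiset (ι × V)) {i : ι} (hi : ∃ a ∈ s, i < a.1) :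
    ∃ j, i < j ∧ (∃ a ∈ s, a.1 = j) ∧ ∀ a ∈ s, a.1 ≤ j := by
  classical
  obtain ⟨a₀, ha₀, hia⟩ := hi
  obtain ⟨a, ha, hmax⟩ := s.toFinset.exists_max_image (fun a => a.1) ⟨a₀, by simpa using ha₀⟩
  refine ⟨a.1, hia.trans_le (hmax a₀ (by simpa using ha₀)), ⟨a, by simpa using ha, rfl⟩, ?_⟩
  intro b hb
  exact hmax b (by simpa using hb)

theorem stageWitness_mem_itSum {i j : ι} {b : G} (hb : b ∈ builtBefore v i) (hij : i < j) :
    stageWitness v i b ∈ itSum (builtBefore v j) (k + 1) := by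
  classical
  obtain ⟨i₀, hi₀, a, rfl⟩ := hb
  have := map_sum_mem_itSum_builtBefore v j
    ((i₀, a) ::ₘ (Finset.univ.val.map fun l : Fin k => (i, Sum.inr l))) (by
      intro c hc
      rcases Multiset.mem_cons.1 hc with rfl | hc
      · exact hi₀.trans hij
      · obtain ⟨l, -, rfl⟩ := Multiset.mem_map.1 hc
        exact hij)
  rw [Multiset.map_cons, Multiset.sum_cons, sum_map_map_univ] at this
  simpa [stageWitness] using this

/-- Modulo `F`, a witness has no representation which is too short. -/
theorem not_short_representation (hM1 : (1 : ℤ) ∉ M) (hMF : ∀ r ∈ M, ∀ e : G, r • e ∈ F)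
    (hv : ∀ i, IsStage M F k (builtBefore v i) (φ i) (v i)) {i : ι} {b : G}
    (hb : b ∈ builtBefore v i) (s : Multiset (ι × (Fin (k + 1) ⊕ Fin k)))
    (hcard : s.card < k) : (s.map fun a => v a.1 a.2).sum - stageWitness v i b ∉ F := by
  classical
  induction hn : s.card using Nat.strong_induction_on generalizing s with
  | _ n ih =>
    intro hsum
    by_cases hi : ∃ a ∈ s, i < a.1
    · obtain ⟨j, hij, hj, hmax⟩ := exists_max_stage s hi
      obtain ⟨h1, h2⟩ := discard_stage hM1 hMF hv (stageWitness_mem_itSum hb hij) s hmax hj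
        (Or.inl hcard.le) hsum
      exact ih _ (by omega) _ (by omega) rfl h1
    · push Not at hi
      obtain ⟨-, hinr⟩ := count_mem_of_le_stage hv hb s hi (by omega) hsum
      have hpos : ∀ l, 1 ≤ s.count (i, Sum.inr l) := by
        intro l
        by_contra h0
        have h0 : s.count (i, Sum.inr l) = 0 := by omega
        have := hinr l
        rw [h0] at this
        exact hM1 (by simpa using this)
      have hge : k ≤ ∑ l, s.count (i, Sum.inr l) := by
        simpa using Finset.sum_le_sum (s := Finset.univ) fun l _ => hpos l
      have h2 := card_eq_filter_lt_add i s hi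
      rw [Fintype.sum_sum_type] at h2
      omega

theorem stage_le_of_representation (hM1 : (1 : ℤ) ∉ M) (hMF : ∀ r ∈ M, ∀ e : G, r • e ∈ F)
    (hv : ∀ i, IsStage M F k (builtBefore v i) (φ i) (v i)) {i : ι} {b : G}
    (hb : b ∈ builtBefore v i) (s : Multiset (ι × (Fin (k + 1) ⊕ Fin k)))
    (hcard : s.card = k + 1) (hsum : (s.map fun a => v a.1 a.2).sum = stageWitness v i b) :
    ∀ a ∈ s, a.1 ≤ i := by
  by_contra! hi
  obtain ⟨j, hij, hj, hmax⟩ := exists_max_stage s hi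
  obtain ⟨h1, h2⟩ := discard_stage hM1 hMF hv (stageWitness_mem_itSum hb hij) s hmax hj
    (Or.inr ⟨hcard, hsum⟩) (by simp [hsum])
  exact not_short_representation hM1 hMF hv hb _ (by omega) h1

/-- Every representation of a witness of `b` uses `b`. -/
theorem exists_mem_of_representation (hk : 1 ≤ k) (hM1 : (1 : ℤ) ∉ M)
    (hMF : ∀ r ∈ M, ∀ e : G, r • e ∈ F)
    (hv : ∀ i, IsStage M F k (builtBefore v i) (φ i) (v i)) {i : ι} {b : G}
    (hb : b ∈ builtBefore v i) (s : Multiset (ι × (Fin (k + 1) ⊕ Fin k)))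
    (hcard : s.card = k + 1) (hsum : (s.map fun a => v a.1 a.2).sum = stageWitness v i b) :
    ∃ a ∈ s, v a.1 a.2 = b := by
  classical
  have hi := stage_le_of_representation hM1 hMF hv hb s hcard hsum
  obtain ⟨hinl, hinr⟩ := count_mem_of_le_stage hv hb s hi hcard.le (by simp [hsum])
  have hpos : ∀ l, 1 ≤ s.count (i, Sum.inr l) := by
    intro l
    by_contra h0
    have h0 : s.count (i, Sum.inr l) = 0 := by omega
    have := hinr l
    rw [h0] at this
    exact hM1 (by simpa using this)
  have hone : ∀ l, s.count (i, Sum.inr l) ≠ 2 := by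
    intro l h0
    have := hinr l
    rw [h0] at this
    exact hM1 (by simpa using this)
  have h1 := map_sum_eq_filter_lt_add (fun a : ι × (Fin (k + 1) ⊕ Fin k) => v a.1 a.2) i s hi
  have h2 := card_eq_filter_lt_add i s hi
  rw [Fintype.sum_sum_type] at h1 h2
  have hr1 : ∀ l, s.count (i, Sum.inr l) = 1 := by
    intro l
    have h3 := Finset.add_sum_erase Finset.univ (fun l => s.count (i, Sum.inr l)) (Finset.mem_univ l)
    have h4 : k - 1 ≤ ∑ l' ∈ Finset.univ.erase l, s.count (i, Sum.inr l') := by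
      simpa using Finset.sum_le_sum (s := Finset.univ.erase l) fun l' _ => hpos l'
    have := hpos l
    have := hone l
    omega
  have hr : ∑ l, s.count (i, Sum.inr l) = k := by simp [hr1]
  have hl0 : ∀ l, s.count (i, Sum.inl l) = 0 := by
    intro l
    by_contra h0
    obtain ⟨l', hl'⟩ : ∃ l' : Fin (k + 1), l' ≠ l := by
      have : Nontrivial (Fin (k + 1)) := Fin.nontrivial_iff_two_le.2 (by omega)
      exact exists_ne l
    have h3 := Finset.sum_le_sum_of_subset (f := fun l => s.count (i, Sum.inl l))
      (Finset.subset_univ {l, l'})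
    rw [Finset.sum_pair hl'.symm] at h3
    have h4 : s.count (i, Sum.inl l) = 1 := by omega
    have h5 : s.count (i, Sum.inl l') = 0 := by omega
    have := hinl l l'
    rw [h4, h5] at this
    exact hM1 (by simpa using this)
  have hl : ∑ l, s.count (i, Sum.inl l) = 0 := by simp [hl0]
  obtain ⟨a, ha⟩ := Multiset.card_eq_one.1 (show (s.filter fun a => a.1 < i).card = 1 by omega)
  refine ⟨a, Multiset.mem_of_mem_filter (ha ▸ Multiset.mem_singleton_self a), ?_⟩
  rw [hsum, ha] at h1
  simpa [stageWitness, hl0, hr1] using h1.symm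

end Representations

theorem itSum_mono {G : Type*} [AddCommGroup G] {A B : Set G} (hAB : A ⊆ B) (n : ℕ) :
    itSum A n ⊆ itSum B n := by
  induction n with
  | zero => exact subset_rfl
  | succ n ih => exact Set.add_subset_add ih hAB

theorem not_simEq_univ_of_injOn {G ι : Type*} [AddCommGroup G] {A : Set G} {T : Set ι}
    (hT : T.Infinite) (f : ι → G) (hf : Set.InjOn f T) (hA : ∀ i ∈ T, f i ∉ A) :
    ¬ SimEq A Set.univ := by
  intro h
  refine hT (Set.Finite.of_finite_image (h.subset ?_) hf)
  rintro _ ⟨i, hi, rfl⟩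
  exact Or.inr ⟨trivial, hA i hi⟩

theorem stmt_8 {G : Type*} [AddCommGroup G] [Infinite G] (h : ℕ) (hh : 2 ≤ h) :
    ∃ B : Set G, itSum B h = Set.univ ∧
      (∀ g, 1 ≤ g → g < h → ¬ SimEq (itSum B g) Set.univ) ∧
      (∀ b ∈ B, ¬ SimEq (itSum (B \ {b}) h) Set.univ) := by
  classical
  obtain ⟨k, rfl⟩ : ∃ k, h = k + 1 := ⟨h - 1, by omega⟩
  have hk : 1 ≤ k := by omega
  have hκ : ℵ₀ ≤ #G := aleph0_le_mk G
  obtain ⟨M, F, hF, hM1, hMF, hM⟩ := exists_small_multiples (G := G)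
  let ι := (#G).ord.ToType
  have hIio : ∀ i : ι, #(Set.Iio i) < #G := fun i => by
    simpa [ι] using mk_Iio_lt i (by simp [ι])
  obtain ⟨φ⟩ : Nonempty (ι ≃ G) := Cardinal.eq.1 (mk_ord_toType _)
  obtain ⟨v, hv⟩ : ∃ v : ι → Fin (k + 1) ⊕ Fin k → G,
      ∀ i, IsStage M F k (builtBefore v i) (φ i) (v i) := by
    refine exists_stages (fun B i w => IsStage M F k B (φ i) w) fun i v =>
      exists_isStage M F hF hMF hM k _ ?_ _
    have : {x | ∃ j < i, ∃ a, v j a = x} =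
        ⋃ a ∈ (Finset.univ : Finset (Fin (k + 1) ⊕ Fin k)), (fun j => v j a) '' Set.Iio i := by
      ext x
      simp only [Set.mem_ofPred_eq, Set.mem_iUnion, Finset.mem_univ, Set.mem_image, Set.mem_Iio,
        exists_prop, true_and]
      exact ⟨fun ⟨j, hj, a, ha⟩ => ⟨a, j, hj, ha⟩, fun ⟨a, j, hj, ha⟩ => ⟨j, hj, a, ha⟩⟩
    rw [this]
    exact mk_biUnion_finset_lt hκ _ _ fun a _ => mk_image_le.trans_lt (hIio i)
  have hinf : ∀ i : ι, (Set.Ioi i).Infinite := by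
    intro i hfin
    have h1 : #(Set.univ : Set ι) < #G := by
      have : (Set.univ : Set ι) ⊆ Set.Iio i ∪ ({i} ∪ Set.Ioi i) := fun j _ => by
        rcases lt_trichotomy j i with h | h | h
        · exact Or.inl h
        · exact Or.inr (Or.inl h)
        · exact Or.inr (Or.inr h)
      exact (mk_le_mk_of_subset this).trans_lt ((mk_union_le _ _).trans_lt
        (add_lt_of_lt hκ (hIio i)
          (mk_finite_lt hκ ((Set.finite_singleton i).union hfin))))
    rw [mk_univ, mk_ord_toType] at h1
    exact h1.false
  let u : ι × (Fin (k + 1) ⊕ Fin k) → G := fun a => v a.1 a.2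
  have hmem : ∀ a, u a ∈ Set.range u := fun a => ⟨a, rfl⟩
  have hrep : ∀ n x, x ∈ itSum (Set.range u) n ↔
      ∃ s : Multiset (ι × (Fin (k + 1) ⊕ Fin k)), s.card = n ∧ (s.map u).sum = x := by
    intro n x
    rw [← Set.image_univ, mem_itSum_image_iff]
    simp
  have hbuilt : ∀ i, builtBefore v i ⊆ Set.range u := by
    rintro i _ ⟨j, -, a, rfl⟩
    exact hmem (j, a)
  have hself : ∀ {i j} a, i < j → v i a ∈ builtBefore v j := fun {i j} a hij => ⟨i, hij, a, rfl⟩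
  obtain ⟨i₀⟩ : Nonempty ι := φ.nonempty_congr.2 inferInstance
  let c₀ : Fin (k + 1) ⊕ Fin k := Sum.inr ⟨0, hk⟩
  refine ⟨Set.range u, Set.eq_univ_of_forall fun g => ?_, fun g _ hg => ?_, ?_⟩
  · rcases (hv (φ.symm g)).hits with hit | hit
    · rw [φ.apply_symm_apply] at hit
      exact itSum_mono (hbuilt _) _ hit
    · rw [φ.apply_symm_apply] at hit
      refine (hrep _ _).2 ⟨Finset.univ.val.map fun l : Fin (k + 1) => (φ.symm g, Sum.inl l),
        by simp, ?_⟩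
      rw [sum_map_map_univ]
      exact hit
  · obtain ⟨i, hi⟩ := (hinf i₀).nonempty
    have hb : v i₀ c₀ ∈ builtBefore v i := hself _ hi
    let x := stageWitness v i (v i₀ c₀)
    refine not_simEq_univ_of_injOn (hinf i)
      (fun j => x - (k - g) • v i₀ c₀ - v j c₀) ?_ ?_
    · have hne : ∀ j j', j < j' → v j c₀ ≠ v j' c₀ := by
        intro j j' hjj' heq
        have := ((hv j').generic (fun a => if a = c₀ then 1 else 0)
          (fun a => by
            have : (0 : ℤ) ≤ k := by positivity
            split_ifs
            · rw [abs_one]; linarith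
            · rw [abs_zero]; linarith)
          1 (by omega) 0 (by omega) (v j c₀) ⟨0, rfl, _, hself _ hjj', zero_add _⟩ 0 rfl 0
          F.zero_mem (by simp [heq])).2 ⟨0, hk⟩
        exact hM1 (by simpa [c₀] using this)
      intro j _ j' _ hjj'
      have heq : v j c₀ = v j' c₀ := by simpa using hjj'
      rcases lt_trichotomy j j' with h | h | h
      · exact absurd heq (hne _ _ h)
      · exact h
      · exact absurd heq.symm (hne _ _ h)
    · intro j hj hmem
      obtain ⟨s, hs, hsum⟩ := (hrep _ _).1 hmem
      have := stage_le_of_representation hM1 hMF hv hb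
        ((j, c₀) ::ₘ (Multiset.replicate (k - g) (i₀, c₀) + s)) (by simp [hs]; omega) (by
          change Multiset.sum (Multiset.map u _) = x
          simp only [Multiset.map_cons, Multiset.map_add, Multiset.sum_cons, Multiset.sum_add,
            Multiset.map_replicate, Multiset.sum_replicate, hsum, u]
          abel) (j, c₀) (Multiset.mem_cons_self _ _)
      exact absurd hj (not_lt.2 this)
  · rintro _ ⟨⟨i₁, c⟩, rfl⟩
    refine not_simEq_univ_of_injOn (hinf i₁) (fun i => stageWitness v i (v i₁ c)) ?_ ?_
    · have hne : ∀ i i', i₁ < i → i < i' →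
          stageWitness v i (v i₁ c) ≠ stageWitness v i' (v i₁ c) := by
        intro i i' hi hii' heq
        have := stage_le_of_representation hM1 hMF hv (hself c hi)
          ((i₁, c) ::ₘ (Finset.univ.val.map fun l : Fin k => (i', Sum.inr l)))
          (by simp) (by
            rw [heq, Multiset.map_cons, Multiset.sum_cons, sum_map_map_univ]
            rfl) (i', c₀)
          (Multiset.mem_cons_of_mem (Multiset.mem_map.2 ⟨⟨0, hk⟩, by simp, rfl⟩))
        exact absurd hii' (not_lt.2 this)
      intro i hi i' hi' heq
      rcases lt_trichotomy i i' with h | h | h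
      · exact absurd heq (hne _ _ hi h)
      · exact h
      · exact absurd heq.symm (hne _ _ hi' h)
    · intro i hi hmem
      have himage : Set.range u \ {u (i₁, c)} = u '' {a | u a ≠ u (i₁, c)} := by
        ext x
        constructor
        · rintro ⟨⟨a, rfl⟩, ha⟩
          exact ⟨a, ha, rfl⟩
        · rintro ⟨a, ha, rfl⟩
          exact ⟨⟨a, rfl⟩, ha⟩
      rw [himage] at hmem
      obtain ⟨s, hs, hsT, hsum⟩ := (mem_itSum_image_iff _ _ _ _).1 hmem
      obtain ⟨a, ha, hab⟩ := exists_mem_of_representation hk hM1 hMF hv (hself c hi) s hs hsum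
      exact hsT a ha hab
end
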